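/- Let $V$ be a Henselian valuation ring of a field $K$ containing an algebraically closed field $k$ of characteristic zero with $k \cong V/m_V$. Let $L$ be a finite field extension of $K$. Then there is a unique valuation ring $W$ of $L$ dominating $V$, the extension $L/K$ is Galois, and the Galois group of $L/K$ is isomorphic to $\Gamma_W/\Gamma_V$, where $\Gamma_W$ and $\Gamma_V$ are the value groups of $W$ and $V$. -/

import Mathlib

namespace ValuationSubring

section Extension

variable {K L : Type*} [Field K] [Field L] [Algebra K L] {V : ValuationSubring K}
  {W : ValuationSubring L}

/-- Every valuation subring of `K` extends to any extension field `L`. -/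
theorem exists_mem_algebraMap_iff (V : ValuationSubring K) (L : Type*) [Field L] [Algebra K L] :
    ∃ W : ValuationSubring L, ∀ x : K, algebraMap K L x ∈ W ↔ x ∈ V := by
  obtain ⟨W, hW⟩ := (V.toLocalSubring.map (algebraMap K L)).exists_le_valuationSubring
  obtain ⟨hle, hloc⟩ := LocalSubring.le_def.mp hW
  have hVW : V ≤ W.comap (algebraMap K L) := fun x hx ↦ hle ⟨x, hx, rfl⟩
  refine ⟨W, fun x ↦ ⟨fun hx ↦ ?_, fun hx ↦ hVW hx⟩⟩
  by_contra hxV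
  have hx0 : x ≠ 0 := by rintro rfl; exact hxV V.zero_mem
  have hinv : x⁻¹ ∈ V := (V.mem_or_inv_mem x).resolve_left hxV
  have hmem : algebraMap K L x⁻¹ ∈ (V.toLocalSubring.map (algebraMap K L)).toSubring :=
    ⟨x⁻¹, hinv, rfl⟩
  have hu : IsUnit (Subring.inclusion hle ⟨_, hmem⟩) := by
    refine IsUnit.of_mul_eq_one ⟨algebraMap K L x, hx⟩ (Subtype.ext ?_)
    simp [hx0]
  obtain ⟨⟨_, y, hy, rfl⟩, hy'⟩ := (hloc.map_nonunit _ hu).exists_right_inv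
  have h1 : algebraMap K L (x⁻¹ * y) = 1 := by
    simpa using congrArg Subtype.val hy'
  have h2 : x⁻¹ * y = 1 := (algebraMap K L).injective (by simpa using h1)
  have h3 : y = x := by field_simp at h2; exact h2
  exact hxV (h3 ▸ hy)

theorem valuation_algebraMap_le_one_iff (hW : ∀ x : K, algebraMap K L x ∈ W ↔ x ∈ V) (x : K) :
    W.valuation (algebraMap K L x) ≤ 1 ↔ V.valuation x ≤ 1 := by
  rw [valuation_le_one_iff, valuation_le_one_iff, hW]

theorem valuation_algebraMap_lt_one_iff (hW : ∀ x : K, algebraMap K L x ∈ W ↔ x ∈ V) (x : K) :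
    W.valuation (algebraMap K L x) < 1 ↔ V.valuation x < 1 := by
  rcases eq_or_ne x 0 with rfl | hx
  · simp
  have := (valuation_algebraMap_le_one_iff hW x⁻¹).not
  rw [map_inv₀, map_inv₀, map_inv₀, inv_le_one₀ (by simpa [zero_lt_iff] using hx),
    inv_le_one₀ (by simpa [zero_lt_iff] using hx), not_le, not_le] at this
  exact this

theorem valuation_algebraMap_eq_one {k : Subfield K} (hkV : (k : Set K) ⊆ (V : Set K))
    (hW : ∀ x : K, algebraMap K L x ∈ W ↔ x ∈ V) {c : K} (hc : c ∈ k) (hc0 : c ≠ 0) :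
    W.valuation (algebraMap K L c) = 1 := by
  refine le_antisymm ((valuation_le_one_iff _ _).2 ((hW c).2 (hkV hc))) ?_
  have := (valuation_le_one_iff _ _).2 ((hW c⁻¹).2 (hkV (k.inv_mem hc)))
  rwa [map_inv₀, map_inv₀, inv_le_one₀ (by simpa [zero_lt_iff] using hc0)] at this

theorem valuation_natCast_eq_one {k : Subfield K} [CharZero K] (hkV : (k : Set K) ⊆ (V : Set K))
    (hW : ∀ x : K, algebraMap K L x ∈ W ↔ x ∈ V) {n : ℕ} (hn : n ≠ 0) :
    W.valuation (n : L) = 1 := by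
  simpa using valuation_algebraMap_eq_one hkV hW (natCast_mem k n) (Nat.cast_ne_zero.2 hn)

open Polynomial in
/-- If the residue field of `V` is covered by the algebraically closed field `k`, then so is the
residue of any element of `W` that is integral over `V`. -/
theorem exists_valuation_sub_lt_one {k : Subfield K} [IsAlgClosed k]
    (hres : ∀ v ∈ V, ∃ c ∈ k, V.valuation (v - c) < 1)
    (hW : ∀ x : K, algebraMap K L x ∈ W ↔ x ∈ V) {x : L} (hx : x ∈ W) {p : K[X]} (hp : p.Monic)
    (hpV : ∀ n, p.coeff n ∈ V) (hpx : aeval x p = 0) :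
    ∃ c ∈ k, W.valuation (x - algebraMap K L c) < 1 := by
  choose r hrk hr using fun n ↦ hres _ (hpV n)
  let q : k[X] := X ^ p.natDegree + ∑ i : Fin p.natDegree, C ⟨r i, hrk i⟩ * X ^ (i : ℕ)
  have hq : q.Monic := monic_X_pow_add (degree_sum_fin_lt _)
  let φ : k →+* L := (algebraMap K L).comp k.subtype
  have hqx : W.valuation (eval₂ φ x q) < 1 := by
    have h1 : eval₂ φ x q =
        -∑ i : Fin p.natDegree, algebraMap K L (p.coeff i - r i) * x ^ (i : ℕ) := by
      rw [hp.as_sum, map_add, map_sum, Finset.sum_range] at hpx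
      simp only [map_pow, aeval_X, map_mul, aeval_C] at hpx
      simp only [q, eval₂_add, eval₂_pow, eval₂_X, eval₂_finsetSum, eval₂_mul, eval₂_C, φ,
        RingHom.comp_apply, Subfield.coe_subtype, map_sub, sub_mul, Finset.sum_sub_distrib]
      linear_combination hpx
    rw [h1, Valuation.map_neg]
    refine Valuation.map_sum_lt _ one_ne_zero fun i _ ↦ ?_
    rw [map_mul, map_pow]
    exact mul_lt_one_of_lt_of_le ((valuation_algebraMap_lt_one_iff hW _).2 (hr i))
      (pow_le_one' ((valuation_le_one_iff _ _).2 hx) _)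
  rw [(IsAlgClosed.splits q).eq_prod_roots_of_monic hq, eval₂_multiset_prod,
    map_multiset_prod] at hqx
  by_contra! hcon
  refine hqx.not_ge (Multiset.one_le_prod fun y hy ↦ ?_)
  simp only [Multiset.map_map, Multiset.mem_map] at hy
  obtain ⟨c, -, rfl⟩ := hy
  simpa [φ] using hcon c c.2

end Extension

section Galois

variable {K L : Type*} [Field K] [Field L] [Algebra K L]
  {V : ValuationSubring K} {W : ValuationSubring L}

theorem exists_algEquiv_of_mem_aroots_minpoly [Normal K L] {x y : L}
    (hy : y ∈ (minpoly K x).aroots L) : ∃ σ : L ≃ₐ[K] L, σ x = y := by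
  rw [← isConjRoot_iff_mem_minpoly_aroots (Algebra.IsIntegral.isIntegral x)] at hy
  exact isConjRoot_iff_exists_algEquiv.1 hy.symm

open Polynomial in
theorem coeff_minpoly_mem [Normal K L] (hW : ∀ x : K, algebraMap K L x ∈ W ↔ x ∈ V) {x : L}
    (hx : ∀ σ : L ≃ₐ[K] L, σ x ∈ W) (n : ℕ) : (minpoly K x).coeff n ∈ V := by
  have hmon := minpoly.monic (Normal.isIntegral (F := K) inferInstance x)
  have hlift : (minpoly K x).map (algebraMap K L) ∈ Polynomial.lifts W.subtype := by
    rw [(Normal.splits inferInstance x).eq_prod_roots_of_monic (hmon.map _)]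
    refine multiset_prod_mem _ fun p hp ↦ ?_
    obtain ⟨y, hy, rfl⟩ := Multiset.mem_map.1 hp
    obtain ⟨σ, rfl⟩ := exists_algEquiv_of_mem_aroots_minpoly hy
    exact ⟨X - C ⟨σ x, hx σ⟩, by simp⟩
  obtain ⟨y, hy⟩ := (Polynomial.lifts_iff_coeff_lifts _).1 hlift n
  rw [coeff_map] at hy
  exact (hW _).1 (hy ▸ y.2)

/-- For each element there is a natural number which differs from all its conjugates by an element
of value at least `1`. -/
theorem exists_nat_one_le_valuation_sub [FiniteDimensional K L] {k : Subfield K} [CharZero K]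
    (hkV : (k : Set K) ⊆ (V : Set K)) (hW : ∀ x : K, algebraMap K L x ∈ W ↔ x ∈ V) (x : L) :
    ∃ n : ℕ, ∀ σ : L ≃ₐ[K] L, 1 ≤ W.valuation (σ x - n) := by
  by_contra! hcon
  choose σ hσ using hcon
  obtain ⟨a, b, hab, h⟩ := Finite.exists_ne_map_eq_of_infinite σ
  wlog hlt : a < b generalizing a b
  · exact this b a hab.symm h.symm (lt_of_le_of_ne (not_lt.1 hlt) hab.symm)
  have h1 := Valuation.map_sub_lt _ (hσ a) (h ▸ hσ b)
  have h2 := valuation_natCast_eq_one hkV hW (n := b - a) (by omega)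
  rw [Nat.cast_sub hlt.le] at h2
  rw [sub_sub_sub_cancel_left, h2] at h1
  exact h1.false

/-- The decomposition group: the automorphisms preserving `W`. -/
def stabilizerGroup (K : Type*) [Field K] [Algebra K L] (W : ValuationSubring L) :
    Subgroup (L ≃ₐ[K] L) where
  carrier := {σ | ∀ x, σ x ∈ W ↔ x ∈ W}
  mul_mem' := fun {a b} ha hb x ↦ (ha _).trans (hb x)
  one_mem' := fun _ ↦ Iff.rfl
  inv_mem' := fun {a} ha x ↦ by rw [← ha, ← AlgEquiv.mul_apply, mul_inv_cancel, AlgEquiv.one_apply]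

theorem exists_mem_apply_notMem [FiniteDimensional K L] {σ : L ≃ₐ[K] L}
    (hσ : σ ∉ stabilizerGroup K W) :
    ∃ x ∈ W, σ x ∉ W := by
  by_contra! hcon
  refine hσ fun x ↦ ⟨fun hx ↦ ?_, hcon x⟩
  have hpow : ∀ n : ℕ, ∀ y ∈ W, (σ ^ n) y ∈ W := by
    intro n
    induction n with
    | zero => exact fun y hy ↦ hy
    | succ n ih => exact fun y hy ↦ by rw [pow_succ, AlgEquiv.mul_apply]; exact ih _ (hcon y hy)
  have hord := orderOf_pos σ
  have := hpow (orderOf σ - 1) _ hx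
  rwa [← AlgEquiv.mul_apply, ← pow_succ, Nat.sub_add_cancel hord, pow_orderOf_eq_one,
    AlgEquiv.one_apply] at this

theorem valuation_eq_one_of_mem_stabilizerGroup {σ : L ≃ₐ[K] L} (hσ : σ ∈ stabilizerGroup K W)
    {x : L} (hx : W.valuation x = 1) : W.valuation (σ x) = 1 := by
  refine le_antisymm ((valuation_le_one_iff _ _).2 ((hσ x).2 ((valuation_le_one_iff _ _).1 hx.le)))
    ?_
  have hx0 : x ≠ 0 := by rintro rfl; simp at hx
  have h : W.valuation (σ x⁻¹) ≤ 1 := (valuation_le_one_iff _ _).2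
    ((hσ _).2 ((valuation_le_one_iff _ _).1 (by simp [hx])))
  rwa [map_inv₀, map_inv₀, inv_le_one₀ (by simpa [zero_lt_iff] using hx0)] at h

/-- There is an element fixed by the decomposition group of `W`, all of whose conjugates lie in
`W`, which is a unit in `W` and whose conjugates under automorphisms outside
the decomposition group lie in the maximal ideal of `W`. -/
theorem exists_separating [FiniteDimensional K L] {k : Subfield K} [CharZero K]
    (hkV : (k : Set K) ⊆ (V : Set K)) (hW : ∀ x : K, algebraMap K L x ∈ W ↔ x ∈ V) :
    ∃ β : L, (∀ σ ∈ stabilizerGroup K W, σ β = β) ∧ (∀ σ : L ≃ₐ[K] L, σ β ∈ W) ∧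
      W.valuation β = 1 ∧ ∀ σ ∉ stabilizerGroup K W, W.valuation (σ β) < 1 := by
  classical
  have key : ∀ σ : L ≃ₐ[K] L, σ ∉ stabilizerGroup K W → ∃ y : L,
      (∀ τ : L ≃ₐ[K] L, W.valuation (τ y) ≤ 1) ∧ W.valuation y = 1 ∧ W.valuation (σ y) < 1 := by
    intro σ hσ
    obtain ⟨x, hx, hσx⟩ := exists_mem_apply_notMem hσ
    obtain ⟨n, hn⟩ := exists_nat_one_le_valuation_sub hkV hW x
    have hnW : W.valuation (n : L) ≤ 1 := (valuation_le_one_iff _ _).2 (natCast_mem W n)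
    refine ⟨(x - n)⁻¹, fun τ ↦ ?_, ?_, ?_⟩
    · simpa using inv_le_one_of_one_le₀ (hn τ)
    · have h1 : W.valuation (x - n) ≤ 1 :=
        (Valuation.map_sub _ _ _).trans (max_le ((valuation_le_one_iff _ _).2 hx) hnW)
      rw [map_inv₀, le_antisymm h1 (hn 1), inv_one]
    · have h1 : 1 < W.valuation (σ x) := by
        rw [← not_le, valuation_le_one_iff]; exact hσx
      simp only [map_inv₀, map_sub, map_natCast]
      apply inv_lt_one_of_one_lt₀
      rwa [Valuation.map_sub_eq_of_lt_left _ (hnW.trans_lt h1)]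
  choose! y hy1 hy2 hy3 using key
  let S : Finset (L ≃ₐ[K] L) := Finset.univ.filter (· ∉ stabilizerGroup K W)
  let z := ∏ σ ∈ S, y σ
  have hz1 : ∀ τ : L ≃ₐ[K] L, W.valuation (τ z) ≤ 1 := fun τ ↦ by
    simp only [z, map_prod]
    exact Finset.prod_le_one' fun σ hσ ↦ hy1 σ (by simpa [S] using hσ) τ
  have hz2 : W.valuation z = 1 := by
    simp only [z, map_prod]
    exact Finset.prod_eq_one fun σ hσ ↦ hy2 σ (by simpa [S] using hσ)
  have hz3 : ∀ σ ∉ stabilizerGroup K W, W.valuation (σ z) < 1 := fun σ hσ ↦ by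
    have hS : σ ∈ S := by simpa [S] using hσ
    simp only [z, map_prod]
    rw [← Finset.mul_prod_erase _ _ hS]
    refine mul_lt_one_of_lt_of_le (hy3 σ hσ) (Finset.prod_le_one' fun τ hτ ↦ ?_)
    exact hy1 τ (by simpa [S] using (Finset.mem_of_mem_erase hτ)) σ
  refine ⟨∏ h : stabilizerGroup K W, (h : L ≃ₐ[K] L) z, fun σ hσ ↦ ?_, fun σ ↦ ?_, ?_,
    fun σ hσ ↦ ?_⟩
  · rw [map_prod]
    exact Fintype.prod_equiv (Equiv.mulLeft (⟨σ, hσ⟩ : stabilizerGroup K W)) _ _ fun h ↦ rfl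
  · rw [map_prod]
    exact prod_mem fun h _ ↦ (valuation_le_one_iff _ _).1 (hz1 (σ * h))
  · rw [map_prod]
    exact Finset.prod_eq_one fun h _ ↦ valuation_eq_one_of_mem_stabilizerGroup h.2 hz2
  · rw [map_prod, map_prod, ← Finset.mul_prod_erase _ _ (Finset.mem_univ 1)]
    exact mul_lt_one_of_lt_of_le (hz3 σ hσ) (Finset.prod_le_one' fun h _ ↦ hz1 (σ * h))

open Polynomial in
/-- Over a Henselian valuation ring with algebraically closed residue field of characteristic zero,
every automorphism preserves `W`. -/
theorem stabilizerGroup_eq_top [FiniteDimensional K L] [HenselianLocalRing V]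
    {k : Subfield K} [IsAlgClosed k] [CharZero K]
    [IsGalois K L] (hkV : (k : Set K) ⊆ (V : Set K))
    (hres : ∀ v ∈ V, ∃ c ∈ k, V.valuation (v - c) < 1)
    (hW : ∀ x : K, algebraMap K L x ∈ W ↔ x ∈ V) : stabilizerGroup K W = ⊤ := by
  classical
  obtain ⟨β, hfix, hβW, hβ1, hβ⟩ := exists_separating hkV hW
  by_contra hne
  obtain ⟨σ₀, hσ₀⟩ : ∃ σ₀, σ₀ ∉ stabilizerGroup K W := by
    by_contra! h; exact hne (_root_.eq_top_iff.2 fun σ _ ↦ h σ)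
  have hint : IsIntegral K β := Algebra.IsIntegral.isIntegral β
  have hmon := minpoly.monic hint
  have hcoeff := coeff_minpoly_mem hW hβW
  obtain ⟨b, hbk, hb⟩ := exists_valuation_sub_lt_one hres hW (x := β) (hβW 1) hmon hcoeff
    (minpoly.aeval K β)
  obtain ⟨f, hf, -, hfmon⟩ := lifts_and_natDegree_eq_and_monic (f := V.subtype) (p := minpoly K β)
    ((lifts_iff_coeff_lifts _).2 fun n ↦ ⟨⟨_, hcoeff n⟩, rfl⟩) hmon
  let t := ((minpoly K β).aroots L).erase β
  let g : L[X] := (t.map fun y ↦ X - C y).prod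
  have hβmem : β ∈ (minpoly K β).aroots L := by
    rw [mem_aroots]; exact ⟨hmon.ne_zero, minpoly.aeval K β⟩
  have ht : ∀ y ∈ t, W.valuation y < 1 := by
    intro y hy
    have hnodup : ((minpoly K β).aroots L).Nodup :=
      nodup_aroots_iff_of_splits hmon.ne_zero (Normal.splits inferInstance β) |>.2
        (Algebra.IsSeparable.isSeparable K β)
    obtain ⟨hyβ, hy⟩ := hnodup.mem_erase_iff.1 hy
    obtain ⟨σ, rfl⟩ := exists_algEquiv_of_mem_aroots_minpoly hy
    exact hβ σ fun hσ ↦ hyβ (hfix σ hσ)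
  have hfact : (minpoly K β).map (algebraMap K L) = (X - C β) * g := by
    rw [(Normal.splits inferInstance β).eq_prod_roots_of_monic (hmon.map _)]
    change (((minpoly K β).aroots L).map _).prod = _
    rw [← Multiset.cons_erase hβmem, Multiset.map_cons, Multiset.prod_cons]
  have hb1 : W.valuation (algebraMap K L b) = 1 := by
    have := Valuation.map_sub_eq_of_lt_left W.valuation (x := β) (hb.trans_eq hβ1.symm)
    rwa [sub_sub_cancel, hβ1] at this
  have hgb : W.valuation (g.eval (algebraMap K L b)) = 1 := by
    simp only [g, eval_multiset_prod, map_multiset_prod, Multiset.map_map]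
    refine Multiset.prod_eq_one fun y hy ↦ ?_
    obtain ⟨z, hz, rfl⟩ := Multiset.mem_map.1 hy
    simp only [Function.comp_apply, eval_sub, eval_X, eval_C]
    rw [Valuation.map_sub_eq_of_lt_left _ ((ht z hz).trans_eq hb1.symm), hb1]
  have hg' : W.valuation (g.derivative.eval (algebraMap K L b)) ≤ 1 := by
    have hlift : g ∈ lifts W.subtype := multiset_prod_mem _ fun p hp ↦ by
      obtain ⟨y, hy, rfl⟩ := Multiset.mem_map.1 hp
      exact ⟨X - C ⟨y, (valuation_le_one_iff _ _).1 (ht y hy).le⟩, by simp⟩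
    obtain ⟨g₀, hg₀⟩ := (mem_lifts _).1 hlift
    rw [← hg₀, derivative_map, valuation_le_one_iff]
    have : algebraMap K L b = W.subtype ⟨_, (valuation_le_one_iff _ _).1 hb1.le⟩ := rfl
    rw [this, eval_map, eval₂_hom]
    exact Subtype.prop _
  have hbV : b ∈ V := hkV hbk
  have heval : ∀ p : V[X], algebraMap K L ((p.eval (⟨b, hbV⟩ : V) : V) : K) =
      ((p.map V.subtype).map (algebraMap K L)).eval (algebraMap K L b) := fun p ↦ by
    rw [eval_map, eval₂_hom]
    congr 1
    exact (eval₂_hom V.subtype (⟨b, hbV⟩ : V)).symm.trans (eval_map _ _).symm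
  have hsmall : W.valuation (algebraMap K L b - β) < 1 := by rwa [Valuation.map_sub_swap]
  obtain ⟨γ, hγ, -⟩ := HenselianLocalRing.is_henselian f hfmon ⟨b, hbV⟩ (by
      rw [valuation_lt_one_iff, ← valuation_algebraMap_lt_one_iff hW, heval, hf, hfact, eval_mul,
        map_mul, hgb, mul_one]
      simpa using hsmall) (by
      rw [← IsLocalRing.notMem_maximalIdeal, valuation_lt_one_iff,
        ← valuation_algebraMap_lt_one_iff hW, heval, ← derivative_map, ← derivative_map, hf, hfact,
        derivative_mul, eval_add, eval_mul, eval_mul, not_lt, Valuation.map_add_eq_of_lt_left]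
      · simp [hgb]
      · simp only [map_mul, hgb]
        simpa using mul_lt_one_of_lt_of_le hsmall hg')
  have hroot : (minpoly K β).IsRoot (γ : K) := by
    rw [← hf]; exact hγ.map (f := V.subtype)
  have hdeg := degree_eq_one_of_irreducible_of_root (minpoly.irreducible hint) hroot
  obtain ⟨a, rfl⟩ := minpoly.natDegree_eq_one_iff.1 (natDegree_eq_of_degree_eq_some hdeg)
  have := hβ σ₀ hσ₀
  rw [AlgEquiv.commutes, hβ1] at this
  exact this.false

theorem valuation_apply_eq [FiniteDimensional K L] (hstab : stabilizerGroup K W = ⊤)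
    (σ : L ≃ₐ[K] L) (x : L) : W.valuation (σ x) = W.valuation x := by
  have hmem : ∀ τ : L ≃ₐ[K] L, τ ∈ stabilizerGroup K W := fun τ ↦ hstab ▸ Subgroup.mem_top τ
  have hlt : ∀ (τ : L ≃ₐ[K] L) (y z : L), W.valuation y < W.valuation z →
      W.valuation (τ y) < W.valuation (τ z) := by
    intro τ y z hyz
    have hz : W.valuation z ≠ 0 := (zero_le.trans_lt hyz).ne'
    have hz0 : z ≠ 0 := by simpa using hz
    rcases eq_or_ne y 0 with rfl | hy0
    · simpa [zero_lt_iff] using hz0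
    have h1 : z / y ∉ W := by
      rw [← valuation_le_one_iff, map_div₀, not_le, one_lt_div₀ (by simpa [zero_lt_iff] using hy0)]
      exact hyz
    rwa [← hmem τ (z / y), map_div₀, ← valuation_le_one_iff, map_div₀, not_le,
      one_lt_div₀ (by simpa [zero_lt_iff] using hy0)] at h1
  have hle : ∀ τ : L ≃ₐ[K] L, W.valuation x ≤ W.valuation (τ x) := by
    intro τ
    by_contra! hcon
    have hanti : StrictAnti fun n : ℕ ↦ W.valuation ((τ ^ n) x) :=
      strictAnti_nat_of_succ_lt fun n ↦ by
        simpa [pow_succ] using hlt (τ ^ n) _ _ hcon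
    have := hanti (orderOf_pos τ)
    simp [pow_orderOf_eq_one] at this
  refine le_antisymm ?_ (hle σ)
  by_contra! hcon
  have := hlt σ⁻¹ _ _ hcon
  rw [← AlgEquiv.mul_apply, inv_mul_cancel, AlgEquiv.one_apply] at this
  exact this.not_ge (hle σ⁻¹)

section Pairing

variable [FiniteDimensional K L]

theorem map_div_mem_unitGroup (hstab : stabilizerGroup K W = ⊤) (σ : L ≃ₐ[K] L) (x : Lˣ) :
    Units.map (σ : L →* L) x / x ∈ W.unitGroup := by
  rw [mem_unitGroup_iff, Units.val_div_eq_div_val, map_div₀]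
  simp [valuation_apply_eq hstab]

theorem map_div_mem_principalUnitGroup (hstab : stabilizerGroup K W = ⊤)
    (hresW : ∀ x ∈ W, ∃ c : K, W.valuation (x - algebraMap K L c) < 1)
    (σ : L ≃ₐ[K] L) {x : Lˣ} (hx : x ∈ W.unitGroup) :
    Units.map (σ : L →* L) x / x ∈ W.principalUnitGroup := by
  rw [mem_unitGroup_iff] at hx
  obtain ⟨c, hc⟩ := hresW x ((valuation_le_one_iff _ _).1 hx.le)
  have hc' : W.valuation (σ x - algebraMap K L c) < 1 := by
    rwa [← valuation_apply_eq hstab σ, map_sub, AlgEquiv.commutes] at hc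
  have h : W.valuation (σ x - x) < 1 := by
    simpa using Valuation.map_sub_lt _ hc' hc
  rw [mem_principalUnitGroup_iff, Units.val_div_eq_div_val]
  have : (σ (x : L)) / x - 1 = (σ x - x) / x := by field_simp
  simpa [this, hx] using h

variable (hstab : stabilizerGroup K W = ⊤)
  (hresW : ∀ x ∈ W, ∃ c : K, W.valuation (x - algebraMap K L c) < 1)

/-- The pairing `(σ, x) ↦ σ x / x` of the Galois group with `Lˣ`, with values in the units of the
residue field. -/
noncomputable def galoisPairing :
    (L ≃ₐ[K] L) →* Lˣ →* (IsLocalRing.ResidueField W)ˣ where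
  toFun σ :=
    { toFun x := W.unitGroupToResidueFieldUnits ⟨_, map_div_mem_unitGroup hstab σ x⟩
      map_one' := by
        rw [← map_one W.unitGroupToResidueFieldUnits]
        congr 1
        ext
        simp
      map_mul' x y := by
        rw [← map_mul]
        congr 1
        ext
        simp [mul_div_mul_comm] }
  map_one' := by
    ext x
    simp only [MonoidHom.coe_mk, OneHom.coe_mk, MonoidHom.one_apply]
    rw [← map_one W.unitGroupToResidueFieldUnits]
    congr 2
    ext
    simp
  map_mul' σ τ := by
    refine MonoidHom.ext fun x ↦ ?_
    simp only [MonoidHom.coe_mk, OneHom.coe_mk, MonoidHom.mul_apply]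
    rw [← map_mul, ← div_eq_one, ← map_div, ← MonoidHom.mem_ker, ker_unitGroupToResidueFieldUnits,
      Subgroup.mem_comap]
    convert map_div_mem_principalUnitGroup hstab hresW σ (map_div_mem_unitGroup hstab τ x) using 1
    ext
    simp
    field_simp

theorem galoisPairing_eq_one_iff (σ : L ≃ₐ[K] L) (x : Lˣ) :
    galoisPairing hstab hresW σ x = 1 ↔ W.valuation (σ x - x) < W.valuation x := by
  change W.unitGroupToResidueFieldUnits _ = 1 ↔ _
  rw [← MonoidHom.mem_ker, ker_unitGroupToResidueFieldUnits,
      Subgroup.mem_comap]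
  change W.valuation _ < 1 ↔ _
  have : (σ (x : L)) / x - 1 = (σ x - x) / x := by field_simp
  simp [this, Units.val_div_eq_div_val, div_lt_one₀, zero_lt_iff]

theorem galoisPairing_injective (hnat : ∀ n : ℕ, n ≠ 0 → W.valuation (n : L) = 1) :
    Function.Injective (galoisPairing hstab hresW) := by
  rw [injective_iff_map_eq_one]
  intro σ hσ
  by_contra hne
  obtain ⟨x, hx⟩ : ∃ x, σ x ≠ x := by
    by_contra! h; exact hne (AlgEquiv.ext h)
  have hz : σ x - x ≠ 0 := sub_ne_zero.2 hx
  set z := σ x - x with hz_def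
  have hsum : ∑ i ∈ Finset.range (orderOf σ), (σ ^ i) z = 0 := by
    have : ∀ i ∈ Finset.range (orderOf σ), (σ ^ i) z = (σ ^ (i + 1)) x - (σ ^ i) x := fun i _ ↦ by
      rw [hz_def, map_sub, pow_succ, AlgEquiv.mul_apply]
    rw [Finset.sum_congr rfl this, Finset.sum_range_sub fun i ↦ (σ ^ i) x]
    simp [pow_orderOf_eq_one]
  have h0 : W.valuation z ≠ 0 := by simpa using hz
  have hlt : W.valuation (∑ i ∈ Finset.range (orderOf σ), ((σ ^ i) z - z)) < W.valuation z :=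
    Valuation.map_sum_lt _ h0 fun i _ ↦
      (galoisPairing_eq_one_iff hstab hresW (σ ^ i) (Units.mk0 z hz)).1 (by simp [hσ])
  rw [Finset.sum_sub_distrib, hsum, zero_sub, Valuation.map_neg] at hlt
  simp [hnat _ (orderOf_pos σ).ne'] at hlt

theorem mem_sup_range_of_galoisPairing_eq_one [IsGalois K L]
    (hnat : ∀ n : ℕ, n ≠ 0 → W.valuation (n : L) = 1) {x : Lˣ}
    (hx : ∀ σ, galoisPairing hstab hresW σ x = 1) :
    x ∈ W.unitGroup ⊔ (Units.map (algebraMap K L : K →+* L).toMonoidHom).range := by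
  have h0 : W.valuation (x : L) ≠ 0 := by simp
  have hlt : W.valuation (∑ σ : L ≃ₐ[K] L, (σ (x : L) - x)) < W.valuation (x : L) :=
    Valuation.map_sum_lt _ h0 fun σ _ ↦ (galoisPairing_eq_one_iff hstab hresW σ x).1 (hx σ)
  rw [Finset.sum_sub_distrib, ← trace_eq_sum_automorphisms] at hlt
  set t := Algebra.trace K L x
  have hcard : W.valuation (∑ _σ : L ≃ₐ[K] L, (x : L)) = W.valuation (x : L) := by
    simp [hnat _ Fintype.card_ne_zero]
  have ht : W.valuation (algebraMap K L t) = W.valuation (x : L) := by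
    rw [← hcard] at hlt ⊢
    simpa using Valuation.map_add_eq_of_lt_left W.valuation hlt
  have ht0 : t ≠ 0 := by
    intro h
    rw [h, map_zero, map_zero] at ht
    exact h0 ht.symm
  refine Subgroup.mem_sup.2 ⟨x / Units.map (algebraMap K L).toMonoidHom (Units.mk0 t ht0), ?_, _,
    ⟨Units.mk0 t ht0, rfl⟩, div_mul_cancel _ _⟩
  rw [mem_unitGroup_iff, Units.val_div_eq_div_val, map_div₀]
  simp [ht]

theorem sup_range_le_ker_galoisPairing (σ : L ≃ₐ[K] L) :
    W.unitGroup ⊔ (Units.map (algebraMap K L : K →+* L).toMonoidHom).range ≤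
      (galoisPairing hstab hresW σ).ker := by
  refine sup_le (fun x hx ↦ ?_) ?_
  · have := map_div_mem_principalUnitGroup hstab hresW σ hx
    change W.unitGroupToResidueFieldUnits _ = 1
    rwa [← MonoidHom.mem_ker, ker_unitGroupToResidueFieldUnits, Subgroup.mem_comap]
  · rintro _ ⟨c, rfl⟩
    rw [MonoidHom.mem_ker, galoisPairing_eq_one_iff]
    simp [zero_lt_iff]

end Pairing

end Galois

end ValuationSubring

/-- A pairing of a finite group with another group that is nondegenerate on both sides, with
values in the units of an algebraically closed field of characteristic zero, induces an
isomorphism. -/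
theorem MonoidHom.nonempty_mulEquiv_of_pairing {G A F : Type*} [Group G] [Finite G] [Group A]
    [Field F] [IsAlgClosed F] [CharZero F] (χ : G →* A →* Fˣ) (hχ : Function.Injective χ)
    (hA : ∀ a, (∀ g, χ g a = 1) → a = 1) : Nonempty (G ≃* A) := by
  let _ : CommGroup G :=
    { mul_comm g h := hχ (MonoidHom.ext fun a ↦ by simp [mul_comm]) }
  let _ : CommGroup A :=
    { mul_comm a b := by
        rw [← mul_inv_eq_one]
        exact hA _ fun g ↦ by
          rw [map_mul, map_inv, map_mul, map_mul, mul_comm (χ g a), mul_inv_cancel] }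
  have : NeZero (Monoid.exponent G) := ⟨Monoid.exponent_ne_zero_of_finite⟩
  obtain ⟨e⟩ := CommGroup.monoidHom_mulEquiv_of_hasEnoughRootsOfUnity G F
  have : Finite (G →* Fˣ) := Finite.of_equiv _ e.symm.toEquiv
  have hflip : Function.Injective χ.flip := by
    rw [injective_iff_map_eq_one]
    exact fun a ha ↦ hA a fun g ↦ DFunLike.congr_fun ha g
  have : Finite A := Finite.of_injective _ hflip
  have : NeZero (Monoid.exponent A) := ⟨Monoid.exponent_ne_zero_of_finite⟩
  obtain ⟨e'⟩ := CommGroup.monoidHom_mulEquiv_of_hasEnoughRootsOfUnity A F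
  have : Finite (A →* Fˣ) := Finite.of_equiv _ e'.symm.toEquiv
  have hcard : Nat.card A = Nat.card (G →* Fˣ) := by
    refine le_antisymm (Nat.card_le_card_of_injective _ hflip) ?_
    rw [Nat.card_congr e.toEquiv, ← Nat.card_congr e'.toEquiv]
    exact Nat.card_le_card_of_injective _ hχ
  exact ⟨((MulEquiv.ofBijective χ.flip
    ((Nat.bijective_iff_injective_and_card _).2 ⟨hflip, hcard⟩)).trans e).symm⟩

namespace ValuationSubring

variable {K L : Type*} [Field K] [Field L] [Algebra K L] {V : ValuationSubring K}
  {W : ValuationSubring L}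

open Polynomial in
theorem mem_iff_forall_coeff_minpoly_mem [IsGalois K L] (hstab : stabilizerGroup K W = ⊤)
    (hW : ∀ x : K, algebraMap K L x ∈ W ↔ x ∈ V) (x : L) :
    x ∈ W ↔ ∀ n, (minpoly K x).coeff n ∈ V := by
  refine ⟨fun hx n ↦ coeff_minpoly_mem hW (fun σ ↦ ?_) n, fun h ↦ ?_⟩
  · exact ((hstab ▸ Subgroup.mem_top σ : σ ∈ stabilizerGroup K W) x).2 hx
  · by_contra hx
    have hx1 : 1 < W.valuation x := by rwa [← not_le, valuation_le_one_iff]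
    have hmon := minpoly.monic (Algebra.IsIntegral.isIntegral (R := K) x)
    have h0 := minpoly.aeval K x
    rw [hmon.as_sum, map_add, map_sum, map_pow, aeval_X] at h0
    have hlt : W.valuation (∑ i ∈ Finset.range (minpoly K x).natDegree,
        aeval x (C ((minpoly K x).coeff i) * X ^ i)) <
          W.valuation (x ^ (minpoly K x).natDegree) := by
      refine Valuation.map_sum_lt _ (by simpa using fun h ↦ by simp [h] at hx1) fun i hi ↦ ?_
      simp only [map_mul, map_pow, aeval_C, aeval_X]
      exact (mul_le_of_le_one_left' ((valuation_le_one_iff _ _).2 ((hW _).2 (h i)))).trans_lt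
        (pow_lt_pow_right₀ hx1 (Finset.mem_range.1 hi))
    have := Valuation.map_add_eq_of_lt_left W.valuation hlt
    rw [h0, map_zero] at this
    exact (zero_le.trans_lt hlt).ne this

theorem exists_residue [IsGalois K L] {k : Subfield K} [IsAlgClosed k]
    (hres : ∀ v ∈ V, ∃ c ∈ k, V.valuation (v - c) < 1)
    (hstab : stabilizerGroup K W = ⊤) (hW : ∀ x : K, algebraMap K L x ∈ W ↔ x ∈ V) {x : L}
    (hx : x ∈ W) : ∃ c ∈ k, W.valuation (x - algebraMap K L c) < 1 :=
  exists_valuation_sub_lt_one hres hW hx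
    (minpoly.monic (Algebra.IsIntegral.isIntegral (R := K) x))
    ((mem_iff_forall_coeff_minpoly_mem hstab hW x).1 hx) (minpoly.aeval K x)

theorem isAbelianGalois [FiniteDimensional K L] [HenselianLocalRing V]
    {k : Subfield K} [IsAlgClosed k] [CharZero K]
    [IsGalois K L] (hkV : (k : Set K) ⊆ (V : Set K))
    (hres : ∀ v ∈ V, ∃ c ∈ k, V.valuation (v - c) < 1) : IsAbelianGalois K L := by
  obtain ⟨W, hW⟩ := exists_mem_algebraMap_iff V L
  have hstab := stabilizerGroup_eq_top hkV hres hW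
  have hresW : ∀ x ∈ W, ∃ c : K, W.valuation (x - algebraMap K L c) < 1 := fun x hx ↦
    (exists_residue hres hstab hW hx).imp fun _ h ↦ h.2
  have hinj := galoisPairing_injective hstab hresW fun n hn ↦ valuation_natCast_eq_one hkV hW hn
  exact { is_comm.comm σ τ := hinj (MonoidHom.ext fun x ↦ by simp [mul_comm]) }

theorem eq_of_forall_mem_algebraMap_iff [FiniteDimensional K L] [HenselianLocalRing V]
    {k : Subfield K} [IsAlgClosed k]
    [CharZero K] [IsGalois K L] (hkV : (k : Set K) ⊆ (V : Set K))
    (hres : ∀ v ∈ V, ∃ c ∈ k, V.valuation (v - c) < 1) {W' : ValuationSubring L}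
    (hW : ∀ x : K, algebraMap K L x ∈ W ↔ x ∈ V) (hW' : ∀ x : K, algebraMap K L x ∈ W' ↔ x ∈ V) :
    W = W' := by
  ext x
  rw [mem_iff_forall_coeff_minpoly_mem (stabilizerGroup_eq_top hkV hres hW) hW,
    mem_iff_forall_coeff_minpoly_mem (stabilizerGroup_eq_top hkV hres hW') hW']

theorem nonempty_algEquiv_mulEquiv_quotient [FiniteDimensional K L] [HenselianLocalRing V]
    {k : Subfield K} [IsAlgClosed k]
    [CharZero K] [IsGalois K L] (hkV : (k : Set K) ⊆ (V : Set K))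
    (hres : ∀ v ∈ V, ∃ c ∈ k, V.valuation (v - c) < 1)
    (hW : ∀ x : K, algebraMap K L x ∈ W ↔ x ∈ V) :
    Nonempty ((L ≃ₐ[K] L) ≃*
      Lˣ ⧸ (W.unitGroup ⊔ (Units.map (algebraMap K L : K →+* L).toMonoidHom).range)) := by
  have hstab := stabilizerGroup_eq_top hkV hres hW
  have hresW : ∀ x ∈ W, ∃ c : K, W.valuation (x - algebraMap K L c) < 1 := fun x hx ↦
    (exists_residue hres hstab hW hx).imp fun _ h ↦ h.2
  have hnat : ∀ n : ℕ, n ≠ 0 → W.valuation (n : L) = 1 := fun n hn ↦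
    valuation_natCast_eq_one hkV hW hn
  let φ : k →+* W := ((algebraMap K L).comp k.subtype).codRestrict W.toSubring
    fun c ↦ (hW c).2 (hkV c.2)
  have hφ : Function.Bijective ((IsLocalRing.residue W).comp φ) := by
    refine ⟨RingHom.injective _, fun y ↦ ?_⟩
    obtain ⟨x, rfl⟩ := IsLocalRing.residue_surjective y
    obtain ⟨c, hc, h⟩ := exists_residue hres hstab hW x.2
    refine ⟨⟨c, hc⟩, ?_⟩
    rw [RingHom.comp_apply, eq_comm, ← sub_eq_zero, ← map_sub, IsLocalRing.residue_eq_zero_iff,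
      valuation_lt_one_iff]
    exact h
  let e : IsLocalRing.ResidueField W ≃+* k := (RingEquiv.ofBijective _ hφ).symm
  let ι : (IsLocalRing.ResidueField W)ˣ →* kˣ := Units.map e.toRingHom.toMonoidHom
  have hι : Function.Injective ι := Units.map_injective e.injective
  let P := galoisPairing hstab hresW
  let χ : (L ≃ₐ[K] L) →*
      (Lˣ ⧸ (W.unitGroup ⊔ (Units.map (algebraMap K L : K →+* L).toMonoidHom).range)) →* kˣ :=
    { toFun σ := QuotientGroup.lift _ (ι.comp (P σ)) fun x hx ↦ by
        rw [MonoidHom.mem_ker, MonoidHom.comp_apply,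
          MonoidHom.mem_ker.1 (sup_range_le_ker_galoisPairing hstab hresW σ hx), map_one]
      map_one' := MonoidHom.ext fun a ↦ QuotientGroup.induction_on a fun x ↦ by
        change ι (P 1 x) = 1
        rw [map_one, MonoidHom.one_apply, map_one]
      map_mul' σ τ := MonoidHom.ext fun a ↦ QuotientGroup.induction_on a fun x ↦ by
        change ι (P (σ * τ) x) = ι (P σ x) * ι (P τ x)
        rw [map_mul, MonoidHom.mul_apply, map_mul] }
  refine MonoidHom.nonempty_mulEquiv_of_pairing χ (fun σ τ h ↦ ?_) fun a ha ↦ ?_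
  · refine galoisPairing_injective hstab hresW hnat (MonoidHom.ext fun x ↦ hι ?_)
    exact DFunLike.congr_fun h (QuotientGroup.mk x)
  · obtain ⟨x, rfl⟩ := QuotientGroup.mk_surjective a
    refine (QuotientGroup.eq_one_iff x).2
      (mem_sup_range_of_galoisPairing_eq_one hstab hresW hnat fun σ ↦ hι ?_)
    rw [map_one]
    exact ha σ

end ValuationSubring

/-- Let `V` be a Henselian valuation ring of a field `K` containing
an algebraically closed field `k` of characteristic zero with `k ≅ V/m_V`, and let
`L` be a finite extension of `K`.  Then there is a unique valuation ring `W` of `L`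
dominating `V` (i.e. `W ∩ K = V`), the extension `L/K` is Galois, and the Galois
group of `L/K` is isomorphic to `Γ_W/Γ_V`.  The quotient of value groups
`Γ_W/Γ_V = (Lˣ/Wˣ)/(Kˣ/Vˣ)` is realized as `Lˣ ⧸ (Wˣ ⊔ im Kˣ)`. -/
theorem henselian_valuation_unique_extension_galois
    {K : Type*} [Field K] (V : ValuationSubring K) [HenselianLocalRing V]
    (k : Subfield K) [IsAlgClosed k] [CharZero k]
    (hkV : (k : Set K) ⊆ (V : Set K))
    -- `k → V/m_V` is an isomorphism: every element of `V` is congruent to an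
    -- element of `k` modulo the maximal ideal
    (hres : ∀ v : V, ∃ c : K, c ∈ k ∧ ∃ m : V, ¬ IsUnit m ∧ (v : K) = c + (m : K))
    (L : Type*) [Field L] [Algebra K L] [FiniteDimensional K L] :
    (∃! W : ValuationSubring L, ∀ x : K, algebraMap K L x ∈ W ↔ x ∈ V) ∧
    IsGalois K L ∧
    (∀ W : ValuationSubring L, (∀ x : K, algebraMap K L x ∈ W ↔ x ∈ V) →
      Nonempty ((L ≃ₐ[K] L) ≃*
        Lˣ ⧸ (W.unitGroup ⊔
          (Units.map (algebraMap K L : K →+* L).toMonoidHom).range))) := by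
  have : CharZero K := charZero_of_injective_algebraMap (algebraMap k K).injective
  have hres' : ∀ v ∈ V, ∃ c ∈ k, V.valuation (v - c) < 1 := fun v hv ↦ by
    obtain ⟨c, hc, m, hm, h⟩ := hres ⟨v, hv⟩
    refine ⟨c, hc, ?_⟩
    change v = c + m at h
    rw [h, add_sub_cancel_left, ← V.valuation_lt_one_iff]
    exact hm
  let N := IntermediateField.normalClosure K L (AlgebraicClosure L)
  have : IsAbelianGalois K N := ValuationSubring.isAbelianGalois hkV hres'
  have hab : IsAbelianGalois K L := .tower_bot K L N
  have hgal : IsGalois K L := hab.toIsGalois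
  obtain ⟨W, hW⟩ := V.exists_mem_algebraMap_iff L
  exact ⟨⟨W, hW, fun W' hW' ↦ ValuationSubring.eq_of_forall_mem_algebraMap_iff hkV hres' hW' hW⟩,
    hgal, fun W hW ↦ ValuationSubring.nonempty_algEquiv_mulEquiv_quotient hkV hres' hW⟩
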